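/- Let F be a γ-pliable set family on a finite set V, let I be an inclusion-minimal cover of F such that every edge of I covers some F-core, let U be the union of all F-cores, let L be a laminar witness family for I augmented with V, let (S₀, S₁, …, S_ℓ) be a hollow chain in L with ℓ ≥ 1, and for each i let a_i b_i be the unique edge of I covering S_i with a_i ∈ S_i. If b₁ ∈ U, then ℓ ≤ 3; moreover, if ℓ = 3 then a₁, b₀, a₂ ∉ U and b₁, b₂, a₃ all belong to the same F-core. -/

import Mathlib

open scoped Classical

namespace SFEC

variable {V : Type*}

/-- An edge (an unordered pair of distinct elements) `e` covers a set `S`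
if exactly one endpoint of `e` lies in `S`. -/
def Covers (e : Sym2 V) (S : Set V) : Prop :=
  ∃ u v : V, e = s(u, v) ∧ u ∈ S ∧ v ∉ S

/-- `delta I S` is the set of edges of `I` with exactly one endpoint in `S`. -/
noncomputable def delta (I : Finset (Sym2 V)) (S : Set V) : Finset (Sym2 V) :=
  I.filter (fun e => Covers e S)

/-- `d I S = |delta I S|`. -/
noncomputable def d (I : Finset (Sym2 V)) (S : Set V) : ℕ := (delta I S).card

/-- A set family on `V`: a collection of subsets with `∅ ∉ F` and `V ∉ F`. -/
def IsSetFamily (F : Set (Set V)) : Prop := ∅ ∉ F ∧ Set.univ ∉ F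

/-- `I` covers the family `F` if it covers every member of `F`. -/
def CoversFam (I : Finset (Sym2 V)) (F : Set (Set V)) : Prop := ∀ S ∈ F, 1 ≤ d I S

/-- `I` is an inclusion-minimal cover of `F`. -/
def MinimalCover (I : Finset (Sym2 V)) (F : Set (Set V)) : Prop :=
  CoversFam I F ∧ ∀ J : Finset (Sym2 V), J ⊂ I → ¬ CoversFam J F

/-- At least two of the four statements hold. -/
def AtLeastTwo (p q r s : Prop) : Prop :=
  (p ∧ q) ∨ (p ∧ r) ∨ (p ∧ s) ∨ (q ∧ r) ∨ (q ∧ s) ∨ (r ∧ s)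

/-- A family is pliable if for all `A, B ∈ F` at least two of the four sets
`A ∩ B, A ∪ B, A \ B, B \ A` belong to `F`. -/
def Pliable (F : Set (Set V)) : Prop :=
  ∀ A ∈ F, ∀ B ∈ F, AtLeastTwo (A ∩ B ∈ F) (A ∪ B ∈ F) (A \ B ∈ F) (B \ A ∈ F)

/-- The residual family `F^I`: the members of `F` covered by no edge of `I`. -/
def Residual (F : Set (Set V)) (I : Finset (Sym2 V)) : Set (Set V) := {S ∈ F | d I S = 0}

/-- `A` and `B` cross if `A ∩ B`, `A \ B`, `B \ A` and `V \ (A ∪ B)` are all nonempty. -/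
def Crosses (A B : Set V) : Prop :=
  (A ∩ B).Nonempty ∧ (A \ B).Nonempty ∧ (B \ A).Nonempty ∧ ((A ∪ B)ᶜ : Set V).Nonempty

/-- An `F`-core: an inclusion-minimal member of `F`. -/
def Core (F : Set (Set V)) (C : Set V) : Prop := C ∈ F ∧ ∀ A ∈ F, A ⊆ C → A = C

/-- Property (γ). -/
def PropertyGamma (F : Set (Set V)) : Prop :=
  ∀ (J : Finset (Sym2 V)) (S₁ S₂ C : Set V),
    S₁ ∈ Residual F J → S₂ ∈ Residual F J → S₁ ⊂ S₂ →
    Core (Residual F J) C → Crosses C S₁ → Crosses C S₂ →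
    S₂ \ (S₁ ∪ C) = ∅ ∨ S₂ \ (S₁ ∪ C) ∈ Residual F J

/-- `F` is γ-pliable: pliable and satisfying Property (γ). -/
def GammaPliable (F : Set (Set V)) : Prop := Pliable F ∧ PropertyGamma F

/-- `S` is a witness set for the edge `e ∈ I` if `δ_I(S) = {e}`. -/
def WitnessSet (F : Set (Set V)) (I : Finset (Sym2 V)) (S : Set V) (e : Sym2 V) : Prop :=
  S ∈ F ∧ delta I S = {e}

/-- `L ⊆ F` is a witness family for `I`: `|L| = |I|` and each `e ∈ I` has a witness set in `L`. -/
def WitnessFamily (F : Set (Set V)) (I : Finset (Sym2 V)) (L : Finset (Set V)) : Prop :=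
  ↑L ⊆ F ∧ L.card = I.card ∧ ∀ e ∈ I, ∃ S ∈ L, WitnessSet F I S e

/-- A family is laminar if any two members are disjoint or one contains the other. -/
def Laminar (L : Finset (Set V)) : Prop :=
  ∀ A ∈ L, ∀ B ∈ L, A ⊆ B ∨ B ⊆ A ∨ Disjoint A B

/-- `S ∈ L` owns `C` if `S` is the inclusion-minimal member of `L` containing `C`. -/
def Owns (L : Finset (Set V)) (S C : Set V) : Prop :=
  S ∈ L ∧ C ⊆ S ∧ ∀ T ∈ L, C ⊆ T → S ⊆ T

/-- `S ∈ L` is hollow if it owns no `F`-core. -/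
def Hollow (F : Set (Set V)) (L : Finset (Set V)) (S : Set V) : Prop :=
  S ∈ L ∧ ∀ C : Set V, Core F C → ¬ Owns L S C

/-- `A` is the unique child of `S` in `L`: the unique maximal member of `L`
properly contained in `S`. -/
def UniqueChild (L : Finset (Set V)) (A S : Set V) : Prop :=
  A ∈ L ∧ A ⊂ S ∧ ∀ B ∈ L, B ⊂ S → B ⊆ A

/-- `(S 0, S 1, …, S ℓ)` is a hollow chain in `L`. -/
def HollowChain (F : Set (Set V)) (L : Finset (Set V)) (S : ℕ → Set V) (ℓ : ℕ) : Prop :=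
  (∀ i ≤ ℓ, S i ∈ L) ∧
  (∀ i, 1 ≤ i → i ≤ ℓ → Hollow F L (S i)) ∧
  S ℓ ≠ Set.univ ∧
  (∀ i, 1 ≤ i → i ≤ ℓ → UniqueChild L (S (i - 1)) (S i))

/-- `U`: the union of all `F`-cores. -/
def coreUnion (F : Set (Set V)) : Set V := ⋃₀ {C | Core F C}

/-- `F` is uncrossable. -/
def Uncrossable (F : Set (Set V)) : Prop :=
  ∀ A ∈ F, ∀ B ∈ F, (A ∩ B ∈ F ∧ A ∪ B ∈ F) ∨ (A \ B ∈ F ∧ B \ A ∈ F)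

/-- `F` is semi-uncrossable. -/
def SemiUncrossable (F : Set (Set V)) : Prop :=
  ∀ A ∈ F, ∀ B ∈ F,
    (A ∩ B ∈ F ∧ (A ∪ B ∈ F ∨ A \ B ∈ F ∨ B \ A ∈ F)) ∨ (A \ B ∈ F ∧ B \ A ∈ F)

end SFEC

namespace SFEC

section HollowChains

variable {V : Type*}

/-- Every member of a family on a finite ground set contains a core. -/
theorem exists_core_subset [Finite V] {F : Set (Set V)} {A : Set V} (hA : A ∈ F) :
    ∃ C, Core F C ∧ C ⊆ A := by
  obtain ⟨C, hCA, hC⟩ := (Set.toFinite F).exists_le_minimal hA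
  exact ⟨C, ⟨hC.prop, fun B hB hBC => hBC.antisymm (hC.le_of_le hB hBC)⟩, hCA⟩

/-- In a pliable family, a core that meets a member without being contained in it can be both
added to and removed from that member. -/
theorem Core.union_mem_and_diff_mem {F : Set (Set V)} (hp : Pliable F) {C A : Set V}
    (hC : Core F C) (hA : A ∈ F) (hne : (C ∩ A).Nonempty) (hsub : ¬ C ⊆ A) :
    C ∪ A ∈ F ∧ A \ C ∈ F := by
  have h₁ : C ∩ A ∉ F := fun h =>
    hsub (Set.inter_eq_left.mp (hC.2 _ h Set.inter_subset_left))
  have h₂ : C \ A ∉ F := fun h => by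
    obtain ⟨x, hxC, hxA⟩ := hne
    exact ((hC.2 _ h Set.sdiff_subset).symm ▸ hxC : x ∈ C \ A).2 hxA
  have h := hp C hC.1 A hA
  unfold AtLeastTwo at h
  tauto

/-- Two intersecting cores of a pliable family coincide. -/
theorem Core.eq_of_mem {F : Set (Set V)} (hp : Pliable F) {C D : Set V}
    (hC : Core F C) (hD : Core F D) {x : V} (hxC : x ∈ C) (hxD : x ∈ D) : C = D := by
  by_cases hsub : C ⊆ D
  · exact hD.2 C hC.1 hsub
  · have h := (hC.union_mem_and_diff_mem hp hD.1 ⟨x, hxC, hxD⟩ hsub).2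
    exact absurd hxC ((hD.2 _ h Set.sdiff_subset).symm ▸ hxD : x ∈ D \ C).2

/-- In a pliable family, a core that meets a member without being contained in it crosses it. -/
theorem Core.crosses {F : Set (Set V)} (hF : IsSetFamily F) (hp : Pliable F) {C A : Set V}
    (hC : Core F C) (hA : A ∈ F) (hne : (C ∩ A).Nonempty) (hsub : ¬ C ⊆ A) :
    Crosses C A := by
  obtain ⟨h₁, h₂⟩ := hC.union_mem_and_diff_mem hp hA hne hsub
  refine ⟨hne, Set.sdiff_nonempty.mpr hsub, ?_, ?_⟩
  · exact Set.nonempty_iff_ne_empty.mpr fun h => hF.1 (h ▸ h₂)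
  · exact Set.nonempty_compl.mpr fun h => hF.2 (h ▸ h₁)

/-- An edge covering some core of a pliable family has no core containing both its ends. -/
theorem not_mem_and_mem_of_covers_core {F : Set (Set V)} (hp : Pliable F) {x y : V}
    (h : ∃ C, Core F C ∧ Covers s(x, y) C) {D : Set V} (hD : Core F D) (hx : x ∈ D)
    (hy : y ∈ D) : False := by
  obtain ⟨C, hC, u, v, huv, hu, hv⟩ := h
  rcases Sym2.eq_iff.mp huv with ⟨rfl, rfl⟩ | ⟨rfl, rfl⟩
  · exact hv (hC.eq_of_mem hp hD hu hx ▸ hy)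
  · exact hv (hC.eq_of_mem hp hD hu hy ▸ hx)

/-- In a witness family, a member is determined by the edge covering it. -/
theorem WitnessFamily.eq_of_delta_eq {F : Set (Set V)} {I : Finset (Sym2 V)}
    {L : Finset (Set V)} (hW : WitnessFamily F I L) {A B : Set V} (hA : A ∈ L) (hB : B ∈ L)
    {e : Sym2 V} (hAe : delta I A = {e}) (hBe : delta I B = {e}) : A = B := by
  obtain ⟨-, hcard, hwit⟩ := hW
  choose! f hfL hf using hwit
  have hinj : Set.InjOn f I := fun e₁ h₁ e₂ h₂ h =>
    Finset.singleton_injective ((hf e₁ h₁).2.symm.trans (h ▸ (hf e₂ h₂).2))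
  have hsurj := Finset.surjOn_of_injOn_of_card_le f hfL hinj hcard.le
  obtain ⟨e₁, h₁, rfl⟩ := hsurj hA
  obtain ⟨e₂, h₂, rfl⟩ := hsurj hB
  rw [Finset.singleton_injective ((hf e₁ h₁).2.symm.trans hAe),
    Finset.singleton_injective ((hf e₂ h₂).2.symm.trans hBe)]

variable {F : Set (Set V)} {L : Finset (Set V)} {S : ℕ → Set V} {ℓ : ℕ}

theorem HollowChain.ssubset (h : HollowChain F L S ℓ) {i : ℕ} (hi : i < ℓ) :
    S i ⊂ S (i + 1) :=
  (h.2.2.2 (i + 1) (by omega) hi).2.1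

theorem HollowChain.zero_subset (h : HollowChain F L S ℓ) {i : ℕ} (hi : i ≤ ℓ) :
    S 0 ⊆ S i := by
  induction i with
  | zero => exact subset_rfl
  | succ i ih => exact (ih (by omega)).trans (h.ssubset hi).1

theorem HollowChain.mem (h : HollowChain F (insert Set.univ L) S ℓ) {i : ℕ} (hi : i ≤ ℓ) :
    S i ∈ L := by
  refine Finset.mem_of_mem_insert_of_ne (h.1 i hi) fun hu => ?_
  rcases hi.lt_or_eq with hlt | rfl
  · exact (h.ssubset hlt).2 (hu ▸ Set.subset_univ _)
  · exact h.2.2.1 hu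

/-- A core inside a member of a hollow chain lies in the bottom member. -/
theorem HollowChain.core_subset_zero (hF : IsSetFamily F) (hlam : Laminar L)
    (h : HollowChain F (insert Set.univ L) S ℓ) {C : Set V} (hC : Core F C) {i : ℕ}
    (hi : i ≤ ℓ) (hCS : C ⊆ S i) : C ⊆ S 0 := by
  induction i with
  | zero => exact hCS
  | succ i ih =>
    refine ih (by omega) ?_
    by_contra hnot
    refine (h.2.1 (i + 1) (by omega) hi).2 C hC ⟨h.1 _ hi, hCS, fun T hT hCT => ?_⟩
    by_contra hST
    obtain ⟨x, hx⟩ := Set.nonempty_iff_ne_empty.mpr fun he => hF.1 (he ▸ hC.1)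
    have hTS : T ⊂ S (i + 1) := by
      refine ⟨?_, hST⟩
      rcases Finset.mem_insert.mp hT with rfl | hTL
      · exact absurd (Set.subset_univ _) hST
      rcases hlam T hTL _ (h.mem hi) with h₁ | h₁ | h₁
      · exact h₁
      · exact absurd h₁ hST
      · exact absurd (hCS hx) (Set.disjoint_left.mp h₁ (hCT hx))
    exact hnot (hCT.trans ((h.2.2.2 (i + 1) (by omega) hi).2.2 T hT hTS))

/-- A core meeting a member of a hollow chain but not inside the bottom member swallows the
next layer of the chain. -/
theorem HollowChain.diff_subset_core [Finite V] (hF : IsSetFamily F) (hgp : GammaPliable F)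
    (hLF : ↑L ⊆ F) (hlam : Laminar L) (h : HollowChain F (insert Set.univ L) S ℓ)
    {C : Set V} (hC : Core F C) {i : ℕ} (hi : i < ℓ) (hne : (C ∩ S i).Nonempty)
    (hC₀ : ¬ C ⊆ S 0) : S (i + 1) \ S i ⊆ C := by
  have hres : Residual F ∅ = F := by
    ext A
    simp [Residual, d, delta]
  have hsub := h.ssubset hi
  have hS₁ : S i ∈ F := hLF (h.mem hi.le)
  have hS₂ : S (i + 1) ∈ F := hLF (h.mem hi)
  have hcr₁ : Crosses C (S i) := hC.crosses hF hgp.1 hS₁ hne fun hs =>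
    hC₀ (h.core_subset_zero hF hlam hC hi.le hs)
  have hcr₂ : Crosses C (S (i + 1)) := hC.crosses hF hgp.1 hS₂
    (hne.mono (Set.inter_subset_inter_right C hsub.1)) fun hs =>
      hC₀ (h.core_subset_zero hF hlam hC hi hs)
  have hγ := hgp.2 ∅ (S i) (S (i + 1)) C
  rw [hres] at hγ
  rcases hγ hS₁ hS₂ hsub hC hcr₁ hcr₂ with h₀ | hmem
  · rwa [← Set.sdiff_sdiff, Set.sdiff_eq_empty] at h₀
  · obtain ⟨D, hD, hDsub⟩ := exists_core_subset hmem
    obtain ⟨x, hx⟩ := Set.nonempty_iff_ne_empty.mpr fun he => hF.1 (he ▸ hD.1)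
    have hx₀ := h.core_subset_zero hF hlam hD hi (hDsub.trans Set.sdiff_subset) hx
    exact absurd (Or.inl (h.zero_subset hi.le hx₀)) (hDsub hx).2

end HollowChains

end SFEC

open SFEC

theorem stmt_14
    {V : Type*} [Fintype V]
    (F : Set (Set V)) (hF : IsSetFamily F) (hgp : GammaPliable F)
    (I : Finset (Sym2 V)) (hIe : ∀ e ∈ I, ¬ e.IsDiag)
    (hmin : MinimalCover I F)
    (hcov : ∀ e ∈ I, ∃ C : Set V, Core F C ∧ Covers e C)
    (L : Finset (Set V)) (hWF : WitnessFamily F I L) (hlam : Laminar L)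
    (S : ℕ → Set V) (ℓ : ℕ)
    (hchain : HollowChain F (insert Set.univ L) S ℓ)
    (a b : ℕ → V)
    (hedge : ∀ i ≤ ℓ, s(a i, b i) ∈ I ∧ a i ∈ S i ∧ b i ∉ S i ∧
      delta I (S i) = {s(a i, b i)})
    (hℓ : 1 ≤ ℓ) (hbU : b 1 ∈ coreUnion F) :
    ℓ ≤ 3 ∧ (ℓ = 3 →
      a 1 ∉ coreUnion F ∧ b 0 ∉ coreUnion F ∧ a 2 ∉ coreUnion F ∧
      ∃ C : Set V, Core F C ∧ b 1 ∈ C ∧ b 2 ∈ C ∧ a 3 ∈ C) := by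
  have hp := hgp.1
  have hcovers : ∀ i ≤ ℓ, ∀ j ≤ ℓ, Covers s(a j, b j) (S i) → S i = S j := by
    intro i hi j hj hc
    have hmem : s(a j, b j) ∈ delta I (S i) := Finset.mem_filter.mpr ⟨(hedge j hj).1, hc⟩
    rw [(hedge i hi).2.2.2, Finset.mem_singleton] at hmem
    exact hWF.eq_of_delta_eq (hchain.mem hi) (hchain.mem hj) (hedge i hi).2.2.2
      (hmem ▸ (hedge j hj).2.2.2)
  have hb : ∀ i < ℓ, b i ∈ S (i + 1) := by
    intro i hi
    by_contra hbi
    refine (hchain.ssubset hi).ne (hcovers (i + 1) hi i hi.le ⟨a i, b i, rfl, ?_, hbi⟩).symm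
    exact (hchain.ssubset hi).1 (hedge i hi.le).2.1
  have ha : ∀ i < ℓ, a (i + 1) ∉ S i := by
    intro i hi hai
    refine (hchain.ssubset hi).ne (hcovers i hi.le (i + 1) hi ⟨a (i + 1), b (i + 1), rfl, hai, ?_⟩)
    exact fun hbi => (hedge (i + 1) hi).2.2.1 ((hchain.ssubset hi).1 hbi)
  have hlayer : ∀ {D : Set V}, Core F D → ∀ {i x}, i < ℓ → x ∈ D → x ∈ S i → x ∉ S 0 →
      S (i + 1) \ S i ⊆ D := fun hD _ x hi hxD hxS hx₀ =>
    hchain.diff_subset_core hF hgp hWF.1 hlam hD hi ⟨x, hxD, hxS⟩ fun hs => hx₀ (hs hxD)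
  have hends : ∀ i ≤ ℓ, ∀ {D : Set V}, Core F D → a i ∈ D → b i ∈ D → False :=
    fun i hi _ hD => not_mem_and_mem_of_covers_core hp (hcov _ (hedge i hi).1) hD
  obtain ⟨C, hC, hb₁⟩ := hbU
  have hC : Core F C := hC
  have hb₁₀ : b 1 ∉ S 0 := fun hs => (hedge 1 hℓ).2.2.1 (hchain.zero_subset hℓ hs)
  have hC₃ : 3 ≤ ℓ → S 3 \ S 2 ⊆ C := fun h₃ =>
    hlayer hC (i := 2) (by omega) hb₁ (hb 1 (by omega)) hb₁₀
  refine ⟨?_, ?_⟩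
  · by_contra! h₄
    have ha₃ : a 3 ∈ C := hC₃ (by omega) ⟨(hedge 3 (by omega)).2.1, ha 2 (by omega)⟩
    have hb₃ : b 3 ∈ C := hlayer hC (i := 3) (by omega) hb₁
      ((hchain.ssubset (i := 2) (by omega)).1 (hb 1 (by omega))) hb₁₀
      ⟨hb 3 (by omega), (hedge 3 (by omega)).2.2.1⟩
    exact hends 3 (by omega) hC ha₃ hb₃
  · rintro rfl
    have hC₃ := hC₃ le_rfl
    have hs₁ : S 1 ⊆ S 2 := (hchain.ssubset (i := 1) (by omega)).1
    have hs₀ : S 0 ⊆ S 1 := (hchain.ssubset (i := 0) (by omega)).1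
    have hb₂S : b 2 ∈ S 3 \ S 2 := ⟨hb 2 (by omega), (hedge 2 (by omega)).2.2.1⟩
    have ha₂S : a 2 ∈ S 2 \ S 1 := ⟨(hedge 2 (by omega)).2.1, ha 1 (by omega)⟩
    have hb₂ : b 2 ∈ C := hC₃ hb₂S
    have hunique : ∀ {D : Set V}, Core F D → ∀ {x}, x ∈ D → x ∈ S 2 → x ∉ S 0 → D = C :=
      fun hD _ hxD hxS hx₀ =>
        hD.eq_of_mem hp hC (hlayer hD (i := 2) (by omega) hxD hxS hx₀ hb₂S) hb₂
    refine ⟨?_, ?_, ?_, C, hC, hb₁, hb₂, hC₃ ⟨(hedge 3 le_rfl).2.1, ha 2 (by omega)⟩⟩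
    · rintro ⟨D, hD, hx⟩
      obtain rfl := hunique hD hx (hs₁ (hedge 1 hℓ).2.1) (ha 0 (by omega))
      exact hends 1 hℓ hC hx hb₁
    · rintro ⟨D, hD, hx⟩
      have hx₀ := (hedge 0 (by omega)).2.2.1
      have hx₁ : b 0 ∈ S 1 := hb 0 (by omega)
      obtain rfl := hunique hD hx (hs₁ hx₁) hx₀
      exact hends 2 (by omega) hC (hlayer hC (i := 1) (by omega) hx hx₁ hx₀ ha₂S) hb₂
    · rintro ⟨D, hD, hx⟩
      obtain rfl := hunique hD hx ha₂S.1 fun hs => ha₂S.2 (hs₀ hs)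
      exact hends 2 (by omega) hC hx hb₂
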